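/- (Sternberg–Zumbrun inequality.) Let Ω ⊆ ℝⁿ (n ≥ 2) be a bounded smooth domain, f : ℝ → ℝ a C∞ function, and u a classical semi-stable solution of −Δu = f(u) in Ω with u = 0 on ∂Ω and u > 0 in Ω, with u C∞ on a neighborhood of the closure of Ω. Then for every Lipschitz function η : ℝⁿ → ℝ vanishing on frontier Ω, ∫_{Ω ∩ {x : ∇u(x) ≠ 0}} ( ‖D²u(x)‖_F² − ‖D²u(x)·(∇u(x)/‖∇u(x)‖)‖² ) η(x)² dx ≤ ∫_Ω ‖∇u(x)‖² ‖∇η(x)‖² dx, where D²u(x) is the Hessian matrix of u at x, ‖D²u(x)‖_F² = Σ_{i,j} (∂_i∂_j u(x))² is its squared Frobenius norm, and D²u(x)·v is the vector with i-th component Σ_j ∂_i∂_j u(x) v_j. (Geometrically, the left-hand integrand equals |∇_T|∇u||² + |A|²|∇u|², where |A|² is the squared second fundamental form of the level set of u through x.) -/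

import Mathlib

open MeasureTheory Filter

noncomputable section

/-- The Euclidean Laplacian: trace of the Hessian. -/
def lapl {n : ℕ} (u : EuclideanSpace ℝ (Fin n) → ℝ) (x : EuclideanSpace ℝ (Fin n)) : ℝ :=
  ∑ i : Fin n, fderiv ℝ (fun y => fderiv ℝ u y (EuclideanSpace.single i 1)) x
    (EuclideanSpace.single i 1)

/-- Entries of the Hessian matrix. -/
def hess {n : ℕ} (u : EuclideanSpace ℝ (Fin n) → ℝ) (x : EuclideanSpace ℝ (Fin n))
    (i j : Fin n) : ℝ :=
  fderiv ℝ (fun y => fderiv ℝ u y (EuclideanSpace.single j 1)) x (EuclideanSpace.single i 1)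

/-- A bounded smooth domain of ℝⁿ. -/
def IsSmoothBoundedDomain {n : ℕ} (Ω : Set (EuclideanSpace ℝ (Fin n))) : Prop :=
  IsOpen Ω ∧ Bornology.IsBounded Ω ∧ Ω.Nonempty ∧
  ∃ ρ : EuclideanSpace ℝ (Fin n) → ℝ, ContDiff ℝ (⊤ : ℕ∞) ρ ∧
    Ω = {x | ρ x < 0} ∧ frontier Ω = {x | ρ x = 0} ∧
    ∀ x ∈ frontier Ω, gradient ρ x ≠ 0

/-- Classical solution of −Δu = f(u) in Ω, u = 0 on ∂Ω. -/
def IsClassicalSol {n : ℕ} (Ω : Set (EuclideanSpace ℝ (Fin n))) (f : ℝ → ℝ)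
    (u : EuclideanSpace ℝ (Fin n) → ℝ) : Prop :=
  (∃ U, IsOpen U ∧ closure Ω ⊆ U ∧ ContDiffOn ℝ 2 u U) ∧
  (∀ x ∈ Ω, lapl u x + f (u x) = 0) ∧
  (∀ x ∈ frontier Ω, u x = 0)

/-- Semi-stability of a solution u. -/
def IsSemiStable {n : ℕ} (Ω : Set (EuclideanSpace ℝ (Fin n))) (f : ℝ → ℝ)
    (u : EuclideanSpace ℝ (Fin n) → ℝ) : Prop :=
  ∀ ξ : EuclideanSpace ℝ (Fin n) → ℝ, (∃ K : NNReal, LipschitzWith K ξ) →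
    (∀ x ∈ frontier Ω, ξ x = 0) →
    0 ≤ ∫ x in Ω, (‖gradient ξ x‖ ^ 2 - deriv f (u x) * ξ x ^ 2)

/-- Weak solution of −Δu = f(u) in Ω, u = 0 on ∂Ω. -/
def IsWeakSol {n : ℕ} (Ω : Set (EuclideanSpace ℝ (Fin n))) (f : ℝ → ℝ)
    (u : EuclideanSpace ℝ (Fin n) → ℝ) : Prop :=
  IntegrableOn u Ω volume ∧
  IntegrableOn (fun x => f (u x) * Metric.infDist x (frontier Ω)) Ω volume ∧
  ∀ ξ : EuclideanSpace ℝ (Fin n) → ℝ,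
    (∃ U, IsOpen U ∧ closure Ω ⊆ U ∧ ContDiffOn ℝ 2 ξ U) →
    (∀ x ∈ frontier Ω, ξ x = 0) →
    ∫ x in Ω, (u x * lapl ξ x + f (u x) * ξ x) = 0


open scoped Topology ContDiff Manifold

/-- The partial derivative of `u` in the direction of the `i`-th coordinate vector. -/
def pderiv {n : ℕ} (i : Fin n) (u : EuclideanSpace ℝ (Fin n) → ℝ)
    (x : EuclideanSpace ℝ (Fin n)) : ℝ :=
  fderiv ℝ u x (EuclideanSpace.single i 1)

/-- The `i`-th component of `D²u · ∇u`, which equals half of the `i`-th partial derivative of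
`‖∇u‖²`. -/
def hessGrad {n : ℕ} (u : EuclideanSpace ℝ (Fin n) → ℝ) (i : Fin n)
    (x : EuclideanSpace ℝ (Fin n)) : ℝ :=
  ∑ j, pderiv j u x * pderiv i (pderiv j u) x

section Lipschitz

variable {X : Type*} [PseudoMetricSpace X]

theorem LipschitzWith.exists_mul_of_bounded {f g : X → ℝ} (hf : ∃ K, LipschitzWith K f)
    (hg : ∃ K, LipschitzWith K g) (hfb : ∃ C, ∀ x, |f x| ≤ C) (hgb : ∃ C, ∀ x, |g x| ≤ C) :
    ∃ K, LipschitzWith K (fun x => f x * g x) := by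
  obtain ⟨K, hf⟩ := hf
  obtain ⟨L, hg⟩ := hg
  obtain ⟨A, hA⟩ := hfb
  obtain ⟨B, hB⟩ := hgb
  refine ⟨(|A| * L + |B| * K).toNNReal, LipschitzWith.of_dist_le' fun x y => ?_⟩
  have h1 := hf.dist_le_mul x y
  have h2 := hg.dist_le_mul x y
  rw [Real.dist_eq] at h1 h2 ⊢
  calc |f x * g x - f y * g y| = |f x * (g x - g y) + g y * (f x - f y)| := by ring_nf
    _ ≤ |f x| * |g x - g y| + |g y| * |f x - f y| := by
        rw [← abs_mul, ← abs_mul]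
        exact abs_add_le _ _
    _ ≤ |A| * (L * dist x y) + |B| * (K * dist x y) := by
        have hA' := (hA x).trans (le_abs_self A)
        have hB' := (hB y).trans (le_abs_self B)
        exact add_le_add (mul_le_mul hA' h2 (abs_nonneg _) (abs_nonneg _))
          (mul_le_mul hB' h1 (abs_nonneg _) (abs_nonneg _))
    _ = (|A| * L + |B| * K) * dist x y := by ring

theorem LipschitzWith.indicator_of_eq_zero_frontier {E : Type*} [NormedAddCommGroup E]
    [NormedSpace ℝ E] [FiniteDimensional ℝ E] {s : Set E} {f : E → ℝ} {K : NNReal}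
    (hf : LipschitzWith K f) (h0 : ∀ x ∈ frontier s, f x = 0) :
    LipschitzWith K (s.indicator f) := by
  have key : ∀ x ∈ s, ∀ y ∉ s, |f x| ≤ K * dist x y := by
    intro x hx y hy
    obtain ⟨z, hz, hxz⟩ := exists_mem_frontier_infDist_compl_eq_dist hx
      (fun h => hy (h ▸ Set.mem_univ y))
    have h1 := hf.dist_le_mul x z
    rw [h0 z hz, Real.dist_eq, sub_zero, ← hxz] at h1
    exact h1.trans (by gcongr; exact Metric.infDist_le_dist_of_mem hy)
  refine LipschitzWith.of_dist_le_mul fun x y => ?_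
  by_cases hx : x ∈ s <;> by_cases hy : y ∈ s
  · simpa [hx, hy] using hf.dist_le_mul x y
  · simpa [hx, hy, Real.dist_eq] using key x hx y hy
  · simpa [hx, hy, Real.dist_eq, dist_comm] using key y hy x hx
  · simp only [hx, hy, not_false_eq_true, Set.indicator_of_notMem, dist_self]
    positivity

end Lipschitz

section Pderiv

variable {n : ℕ} {u v : EuclideanSpace ℝ (Fin n) → ℝ} {x : EuclideanSpace ℝ (Fin n)}

theorem gradient_apply_eq_pderiv (u : EuclideanSpace ℝ (Fin n) → ℝ)
    (x : EuclideanSpace ℝ (Fin n)) (i : Fin n) : gradient u x i = pderiv i u x := by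
  have h : inner ℝ (gradient u x) (EuclideanSpace.single i 1) = pderiv i u x := by
    rw [gradient, InnerProductSpace.toDual_symm_apply, pderiv]
  rw [← h, EuclideanSpace.inner_single_right]
  simp

theorem norm_gradient_sq (u : EuclideanSpace ℝ (Fin n) → ℝ) (x : EuclideanSpace ℝ (Fin n)) :
    ‖gradient u x‖ ^ 2 = ∑ i, pderiv i u x ^ 2 := by
  simp [EuclideanSpace.norm_sq_eq, gradient_apply_eq_pderiv]

theorem hess_eq_pderiv (u : EuclideanSpace ℝ (Fin n) → ℝ) (x : EuclideanSpace ℝ (Fin n))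
    (i j : Fin n) : hess u x i j = pderiv i (pderiv j u) x := rfl

theorem ContDiff.pderiv (hu : ContDiff ℝ ∞ u) (i : Fin n) : ContDiff ℝ ∞ (pderiv i u) :=
  (hu.fderiv_right (m := ∞) (by simp)).clm_apply contDiff_const

theorem HasCompactSupport.pderiv (hu : HasCompactSupport u) (i : Fin n) :
    HasCompactSupport (pderiv i u) :=
  hu.fderiv_apply ℝ _

theorem pderiv_comm (hu : ContDiff ℝ ∞ u) (i j : Fin n) (x : EuclideanSpace ℝ (Fin n)) :
    pderiv i (pderiv j u) x = pderiv j (pderiv i u) x := by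
  have hd : DifferentiableAt ℝ (fderiv ℝ u) x :=
    ((hu.fderiv_right (m := ∞) (by simp)).differentiable (by simp)) x
  have key : ∀ k l : Fin n, _root_.pderiv k (_root_.pderiv l u) x =
      fderiv ℝ (fderiv ℝ u) x (EuclideanSpace.single k 1) (EuclideanSpace.single l 1) := by
    intro k l
    change fderiv ℝ (fun y => fderiv ℝ u y (EuclideanSpace.single l 1)) x _ = _
    rw [fderiv_clm_apply hd (differentiableAt_const _)]
    simp
  rw [key, key]
  exact (hu.contDiffAt.isSymmSndFDerivAt (by simpa using WithTop.coe_le_coe.2 (le_top (a := (2 : ℕ∞))))).eq _ _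

theorem pderiv_mul (hu : DifferentiableAt ℝ u x) (hv : DifferentiableAt ℝ v x) (i : Fin n) :
    pderiv i (fun y => u y * v y) x = u x * pderiv i v x + v x * pderiv i u x := by
  simp [pderiv, fderiv_fun_mul hu hv]

theorem pderiv_sq (hu : DifferentiableAt ℝ u x) (i : Fin n) :
    pderiv i (fun y => u y ^ 2) x = 2 * u x * pderiv i u x := by
  simp only [pow_two]
  rw [pderiv_mul hu hu]
  ring

theorem pderiv_sum {ι : Type*} {s : Finset ι} {w : ι → EuclideanSpace ℝ (Fin n) → ℝ}
    (hw : ∀ k ∈ s, DifferentiableAt ℝ (w k) x) (i : Fin n) :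
    pderiv i (fun y => ∑ k ∈ s, w k y) x = ∑ k ∈ s, pderiv i (w k) x := by
  simp [pderiv, fderiv_fun_sum hw]

theorem Filter.EventuallyEq.pderiv_eq (h : u =ᶠ[𝓝 x] v) (i : Fin n) :
    pderiv i u x = pderiv i v x := by
  rw [pderiv, pderiv, h.fderiv_eq]

theorem Filter.EventuallyEq.hess_eq (h : u =ᶠ[𝓝 x] v) (i j : Fin n) :
    hess u x i j = hess v x i j :=
  Filter.EventuallyEq.pderiv_eq (h.eventuallyEq_nhds.mono fun _ hy => hy.pderiv_eq j) i

theorem Filter.EventuallyEq.lapl_eq (h : u =ᶠ[𝓝 x] v) : lapl u x = lapl v x :=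
  Finset.sum_congr rfl fun i _ => h.hess_eq i i

theorem LipschitzWith.abs_pderiv_le {K : NNReal} (hu : LipschitzWith K u) (i : Fin n)
    (x : EuclideanSpace ℝ (Fin n)) : |pderiv i u x| ≤ K := by
  have h := (fderiv ℝ u x).le_opNorm (EuclideanSpace.single i 1)
  rw [PiLp.norm_single, norm_one, mul_one] at h
  exact h.trans (norm_fderiv_le_of_lipschitz ℝ hu)

theorem measurable_pderiv (u : EuclideanSpace ℝ (Fin n) → ℝ) (i : Fin n) :
    Measurable (pderiv i u) :=
  measurable_fderiv_apply_const ℝ u _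

theorem pderiv_eq_zero_of_isLocalMin (h : IsLocalMin u x) (i : Fin n) : pderiv i u x = 0 := by
  simp [pderiv, h.fderiv_eq_zero]

theorem integral_pderiv_mul_eq {K L : NNReal} (hu : LipschitzWith K u) (hv : LipschitzWith L v)
    (hvc : HasCompactSupport v) (i : Fin n) :
    ∫ x, pderiv i u x * v x = -∫ x, pderiv i v x * u x := by
  have h := LipschitzWith.integral_lineDeriv_mul_eq (μ := volume) hu hv hvc
    (EuclideanSpace.single i 1)
  rw [← integral_neg]
  convert h using 1
  · refine integral_congr_ae ?_
    filter_upwards [hu.ae_differentiableAt] with x hx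
    rw [hx.lineDeriv_eq_fderiv, pderiv]
  · refine integral_congr_ae ?_
    filter_upwards [hv.ae_differentiableAt] with x hx
    rw [lineDeriv_neg, hx.lineDeriv_eq_fderiv, pderiv, neg_mul]

end Pderiv

section HessGrad

variable {n : ℕ} {u : EuclideanSpace ℝ (Fin n) → ℝ}

theorem ContDiff.hessGrad (hu : ContDiff ℝ ∞ u) (i : Fin n) : ContDiff ℝ ∞ (hessGrad u i) :=
  ContDiff.sum fun j _ => (hu.pderiv j).mul ((hu.pderiv j).pderiv i)

theorem HasCompactSupport.hessGrad (hu : HasCompactSupport u) (i : Fin n) :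
    HasCompactSupport (hessGrad u i) := by
  refine hu.mono' fun x hx => ?_
  by_contra hxu
  refine hx (Finset.sum_eq_zero fun j _ => ?_)
  have h : _root_.pderiv j u x = 0 := by
    rw [_root_.pderiv, fderiv_of_notMem_tsupport (𝕜 := ℝ) hxu]
    rfl
  rw [h, zero_mul]

theorem pderiv_sum_sq_pderiv (hu : ContDiff ℝ ∞ u) (i : Fin n) (x : EuclideanSpace ℝ (Fin n)) :
    pderiv i (fun y => ∑ j, pderiv j u y ^ 2) x = 2 * hessGrad u i x := by
  have hd : ∀ j, DifferentiableAt ℝ (pderiv j u) x := fun j =>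
    (hu.pderiv j).differentiable (by simp) x
  rw [pderiv_sum (w := fun j y => pderiv j u y ^ 2) fun j _ => (hd j).pow 2, hessGrad,
    Finset.mul_sum]
  refine Finset.sum_congr rfl fun j _ => ?_
  rw [pderiv_sq (hd j), mul_assoc]

theorem sum_pderiv_hessGrad (hu : ContDiff ℝ ∞ u) (x : EuclideanSpace ℝ (Fin n)) :
    ∑ i, pderiv i (hessGrad u i) x =
      ∑ i, ∑ j, hess u x i j ^ 2 + ∑ j, pderiv j u x * pderiv j (lapl u) x := by
  have hd : ∀ j, DifferentiableAt ℝ (pderiv j u) x := fun j =>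
    (hu.pderiv j).differentiable (by simp) x
  have hd2 : ∀ i j, DifferentiableAt ℝ (pderiv i (pderiv j u)) x := fun i j =>
    ((hu.pderiv j).pderiv i).differentiable (by simp) x
  have hl : ∀ j, pderiv j (lapl u) x = ∑ i, pderiv i (pderiv i (pderiv j u)) x := by
    intro j
    have : lapl u = fun y => ∑ i, pderiv i (pderiv i u) y := rfl
    rw [this, pderiv_sum fun i _ => hd2 i i]
    refine Finset.sum_congr rfl fun i _ => ?_
    rw [pderiv_comm (hu.pderiv i)]
    congr 1
    exact funext fun y => pderiv_comm hu j i y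
  have h1 : ∀ i, pderiv i (hessGrad u i) x =
      ∑ j, (pderiv j u x * pderiv i (pderiv i (pderiv j u)) x + hess u x i j ^ 2) := by
    intro i
    have : hessGrad u i = fun y => ∑ j, pderiv j u y * pderiv i (pderiv j u) y := rfl
    rw [this, pderiv_sum (w := fun j y => pderiv j u y * pderiv i (pderiv j u) y)
      fun j _ => (hd j).mul (hd2 i j)]
    refine Finset.sum_congr rfl fun j _ => ?_
    rw [pderiv_mul (hd j) (hd2 i j), hess_eq_pderiv]
    ring
  simp only [h1, hl, Finset.sum_add_distrib, Finset.mul_sum]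
  rw [Finset.sum_comm, add_comm]

theorem pderiv_lapl_of_semilinear {Ω : Set (EuclideanSpace ℝ (Fin n))} (hΩ : IsOpen Ω)
    {f : ℝ → ℝ} (hf : Differentiable ℝ f) (hu : ContDiff ℝ ∞ u)
    (hsol : ∀ x ∈ Ω, lapl u x + f (u x) = 0) {x : EuclideanSpace ℝ (Fin n)} (hx : x ∈ Ω)
    (j : Fin n) : pderiv j (lapl u) x = -(deriv f (u x) * pderiv j u x) := by
  have h : lapl u =ᶠ[𝓝 x] fun y => -f (u y) := by
    filter_upwards [hΩ.mem_nhds hx] with y hy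
    linarith [hsol y hy]
  have hc : HasFDerivAt (fun y => -f (u y)) (-(deriv f (u x) • fderiv ℝ u x)) x :=
    ((hf (u x)).hasDerivAt.comp_hasFDerivAt x ((hu.differentiable (by simp)) x).hasFDerivAt).neg
  rw [h.pderiv_eq, pderiv, hc.fderiv]
  simp [pderiv]

theorem sum_pderiv_hessGrad_of_semilinear {Ω : Set (EuclideanSpace ℝ (Fin n))} (hΩ : IsOpen Ω)
    {f : ℝ → ℝ} (hf : Differentiable ℝ f) (hu : ContDiff ℝ ∞ u)
    (hsol : ∀ x ∈ Ω, lapl u x + f (u x) = 0) {x : EuclideanSpace ℝ (Fin n)} (hx : x ∈ Ω) :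
    ∑ i, pderiv i (hessGrad u i) x =
      ∑ i, ∑ j, hess u x i j ^ 2 - deriv f (u x) * ‖gradient u x‖ ^ 2 := by
  rw [sum_pderiv_hessGrad hu, norm_gradient_sq, Finset.mul_sum, sub_eq_add_neg,
    ← Finset.sum_neg_distrib]
  congr 1
  refine Finset.sum_congr rfl fun j _ => ?_
  rw [pderiv_lapl_of_semilinear hΩ hf hu hsol hx]
  ring

theorem sum_sq_hessGrad_le (u : EuclideanSpace ℝ (Fin n) → ℝ) (x : EuclideanSpace ℝ (Fin n)) :
    ∑ i, hessGrad u i x ^ 2 ≤ ‖gradient u x‖ ^ 2 * ∑ i, ∑ j, hess u x i j ^ 2 := by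
  rw [norm_gradient_sq, Finset.mul_sum]
  exact Finset.sum_le_sum fun i _ => Finset.sum_mul_sq_le_sq_mul_sq _ _ _

theorem sum_sq_hess_mul_normalized_gradient (u : EuclideanSpace ℝ (Fin n) → ℝ)
    (x : EuclideanSpace ℝ (Fin n)) :
    ∑ i, (∑ j, hess u x i j * (gradient u x j / ‖gradient u x‖)) ^ 2 =
      (∑ i, hessGrad u i x ^ 2) / ‖gradient u x‖ ^ 2 := by
  rw [Finset.sum_div]
  refine Finset.sum_congr rfl fun i _ => ?_
  rw [← div_pow, hessGrad, Finset.sum_div]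
  congr 1
  refine Finset.sum_congr rfl fun j _ => ?_
  rw [hess_eq_pderiv, gradient_apply_eq_pderiv]
  ring

theorem pderiv_sqrt_sum_sq_pderiv (hu : ContDiff ℝ ∞ u) {ε : ℝ} (hε : 0 < ε) (i : Fin n)
    (x : EuclideanSpace ℝ (Fin n)) :
    pderiv i (fun y => √(∑ j, pderiv j u y ^ 2 + ε)) x =
      hessGrad u i x / √(∑ j, pderiv j u x ^ 2 + ε) := by
  have hd : DifferentiableAt ℝ (fun y => ∑ j, pderiv j u y ^ 2) x :=
    (ContDiff.sum fun j _ => (hu.pderiv j).pow 2).differentiable (n := ∞) (by simp) x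
  have hpos : 0 < ∑ j, pderiv j u x ^ 2 + ε := by positivity
  have h2 := pderiv_sum_sq_pderiv hu i x
  rw [pderiv] at h2
  rw [pderiv, fderiv_sqrt (hd.add_const ε) hpos.ne', fderiv_add_const]
  simp only [smul_apply, smul_eq_mul, h2]
  field_simp

theorem exists_lipschitzWith_sqrt_sum_sq_pderiv (hu : ContDiff ℝ ∞ u) (huc : HasCompactSupport u)
    {ε : ℝ} (hε : 0 < ε) :
    (∃ K, LipschitzWith K fun y => √(∑ j, pderiv j u y ^ 2 + ε)) ∧
      ∃ C, ∀ y, |√(∑ j, pderiv j u y ^ 2 + ε)| ≤ C := by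
  have hs : ContDiff ℝ ∞ fun y => √(∑ j, pderiv j u y ^ 2 + ε) - √ε :=
    (((ContDiff.sum fun j _ => (hu.pderiv j).pow 2).add contDiff_const).sqrt
      fun y => (by positivity : 0 < ∑ j, pderiv j u y ^ 2 + ε).ne').sub contDiff_const
  have hc : HasCompactSupport fun y => √(∑ j, pderiv j u y ^ 2 + ε) - √ε := by
    refine huc.mono' fun x hx => ?_
    by_contra hxu
    refine hx ?_
    have h : ∀ j, _root_.pderiv j u x = 0 := fun j => by
      rw [_root_.pderiv, fderiv_of_notMem_tsupport (𝕜 := ℝ) hxu]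
      rfl
    simp [h]
  constructor
  · obtain ⟨K, hK⟩ := hs.lipschitzWith_of_hasCompactSupport hc (by simp)
    refine ⟨K, LipschitzWith.of_dist_le_mul fun x y => ?_⟩
    simpa using hK.dist_le_mul x y
  · obtain ⟨C, hC⟩ := hc.exists_bound_of_continuous hs.continuous
    refine ⟨C + √ε, fun y => ?_⟩
    have := hC y
    rw [Real.norm_eq_abs] at this
    have h2 := abs_add_le (√(∑ j, pderiv j u y ^ 2 + ε) - √ε) √ε
    rw [sub_add_cancel, abs_of_nonneg (Real.sqrt_nonneg ε)] at h2
    linarith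

end HessGrad

section StabilityTest

variable {n : ℕ} {Ω : Set (EuclideanSpace ℝ (Fin n))} {u η : EuclideanSpace ℝ (Fin n) → ℝ}

/-- Integration by parts of `η²` against `D²u · ∇u`; no boundary regularity is needed, as the
nonnegative function `η²` has zero derivative wherever it vanishes. -/
theorem setIntegral_sum_pderiv_sq_mul_hessGrad (hu : ContDiff ℝ ∞ u) (huc : HasCompactSupport u)
    (hη : ∃ K, LipschitzWith K η) (hηc : HasCompactSupport η) (hη0 : ∀ x ∉ Ω, η x = 0) :
    ∫ x in Ω, ∑ i, pderiv i (fun y => η y ^ 2) x * hessGrad u i x =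
      -∫ x in Ω, (∑ i, pderiv i (hessGrad u i) x) * η x ^ 2 := by
  have hηb : ∃ C, ∀ x, |η x| ≤ C := hηc.exists_bound_of_continuous hη.choose_spec.continuous
  have hψ : ∃ K, LipschitzWith K fun y => η y ^ 2 := by
    simpa only [pow_two] using LipschitzWith.exists_mul_of_bounded hη hη hηb hηb
  obtain ⟨K, hψ⟩ := hψ
  have hψ0 : ∀ x ∉ Ω, ∀ i, pderiv i (fun y => η y ^ 2) x = 0 := fun x hx i =>
    pderiv_eq_zero_of_isLocalMin (.of_forall fun y => by
      simpa [hη0 x hx] using sq_nonneg (η y)) i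
  rw [setIntegral_eq_integral_of_forall_compl_eq_zero fun x hx => by simp [hψ0 x hx],
    setIntegral_eq_integral_of_forall_compl_eq_zero fun x hx => by simp [hη0 x hx]]
  simp only [Finset.sum_mul]
  have h1 : ∀ i, Integrable fun x => pderiv i (fun y => η y ^ 2) x * hessGrad u i x := fun i =>
    ((hu.hessGrad i).continuous.integrable_of_hasCompactSupport (huc.hessGrad i)).bdd_mul
      (measurable_pderiv _ i).aestronglyMeasurable (.of_forall fun x => hψ.abs_pderiv_le i x)
  have h2 : ∀ i, Integrable fun x => pderiv i (hessGrad u i) x * η x ^ 2 := fun i =>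
    (((hu.hessGrad i).pderiv i).continuous.mul
      hψ.continuous).integrable_of_hasCompactSupport ((huc.hessGrad i).pderiv i).mul_right
  rw [integral_finsetSum _ fun i _ => h1 i, integral_finsetSum _ fun i _ => h2 i,
    ← Finset.sum_neg_distrib]
  refine Finset.sum_congr rfl fun i _ => ?_
  obtain ⟨L, hL⟩ := (hu.hessGrad i).lipschitzWith_of_hasCompactSupport (huc.hessGrad i) (by simp)
  exact integral_pderiv_mul_eq hψ hL (huc.hessGrad i) i

theorem norm_gradient_sq_sqrt_mul (hu : ContDiff ℝ ∞ u) {ε : ℝ} (hε : 0 < ε)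
    {x : EuclideanSpace ℝ (Fin n)} (hη : DifferentiableAt ℝ η x) :
    ‖gradient (fun y => √(∑ j, pderiv j u y ^ 2 + ε) * η y) x‖ ^ 2 =
      ‖gradient u x‖ ^ 2 * ‖gradient η x‖ ^ 2 + ε * ‖gradient η x‖ ^ 2 +
        (∑ i, hessGrad u i x ^ 2) / (‖gradient u x‖ ^ 2 + ε) * η x ^ 2 +
        ∑ i, pderiv i (fun y => η y ^ 2) x * hessGrad u i x := by
  have hc : DifferentiableAt ℝ (fun y => √(∑ j, pderiv j u y ^ 2 + ε)) x :=
    (((ContDiff.sum fun j _ => (hu.pderiv j).pow 2).add contDiff_const).sqrt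
      fun y => (by positivity : 0 < ∑ j, pderiv j u y ^ 2 + ε).ne').differentiable
        (n := ∞) (by simp) x
  have hpos : 0 < ∑ j, pderiv j u x ^ 2 + ε := by positivity
  simp only [norm_gradient_sq]
  rw [← add_mul, Finset.mul_sum, Finset.sum_div, Finset.sum_mul, ← Finset.sum_add_distrib,
    ← Finset.sum_add_distrib]
  refine Finset.sum_congr rfl fun i _ => ?_
  rw [pderiv_mul hc hη, pderiv_sqrt_sum_sq_pderiv hu hε, pderiv_sq hη]
  have hs := Real.sq_sqrt hpos.le
  have hs0 := (Real.sqrt_pos.2 hpos).ne'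
  generalize √(∑ j, pderiv j u x ^ 2 + ε) = s at hs hs0 ⊢
  rw [← hs]
  field_simp
  ring

theorem integrableOn_mul_norm_gradient_sq (hΩb : Bornology.IsBounded Ω)
    {g : EuclideanSpace ℝ (Fin n) → ℝ} (hg : Continuous g) (hη : ∃ K, LipschitzWith K η) :
    IntegrableOn (fun x => g x * ‖gradient η x‖ ^ 2) Ω := by
  obtain ⟨K, hη⟩ := hη
  have hgi : IntegrableOn g Ω :=
    (hg.continuousOn.integrableOn_compact hΩb.isCompact_closure).mono_set subset_closure
  simp only [norm_gradient_sq, Finset.mul_sum]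
  refine integrable_finsetSum _ fun i _ => ?_
  refine hgi.mul_bdd (c := (K : ℝ) ^ 2)
    ((measurable_pderiv η i).pow_const 2).aestronglyMeasurable (.of_forall fun x => ?_)
  rw [norm_pow]
  exact pow_le_pow_left₀ (norm_nonneg _) (hη.abs_pderiv_le i x) 2

/-- The stability inequality tested with `√(‖∇u‖² + ε) η`, after integration by parts. -/
theorem IsSemiStable.setIntegral_regularized_le (hΩ : IsOpen Ω) (hΩb : Bornology.IsBounded Ω)
    {f : ℝ → ℝ} (hf : ContDiff ℝ ∞ f) (hu : ContDiff ℝ ∞ u) (huc : HasCompactSupport u)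
    (hsol : ∀ x ∈ Ω, lapl u x + f (u x) = 0) (hstab : IsSemiStable Ω f u)
    (hη : ∃ K, LipschitzWith K η) (hη0 : ∀ x ∉ Ω, η x = 0) {ε : ℝ} (hε : 0 < ε) :
    ∫ x in Ω, (∑ i, ∑ j, hess u x i j ^ 2 -
        (∑ i, hessGrad u i x ^ 2) / (‖gradient u x‖ ^ 2 + ε)) * η x ^ 2 ≤
      (∫ x in Ω, ‖gradient u x‖ ^ 2 * ‖gradient η x‖ ^ 2) +
        ε * ∫ x in Ω, (‖gradient η x‖ ^ 2 - deriv f (u x) * η x ^ 2) := by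
  have hηc : HasCompactSupport η := by
    refine HasCompactSupport.intro hΩb.isCompact_closure fun x hx => hη0 x fun h => ?_
    exact hx (subset_closure h)
  have hηcont : Continuous η := hη.choose_spec.continuous
  have hηb : ∃ C, ∀ x, |η x| ≤ C := hηc.exists_bound_of_continuous hηcont
  obtain ⟨hcl, hcb⟩ := exists_lipschitzWith_sqrt_sum_sq_pderiv hu huc hε
  have hξ := LipschitzWith.exists_mul_of_bounded hcl hη hcb hηb
  have hint : ∀ {g : EuclideanSpace ℝ (Fin n) → ℝ}, Continuous g → IntegrableOn g Ω :=
    fun hg => (hg.continuousOn.integrableOn_compact hΩb.isCompact_closure).mono_set subset_closure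
  have hgc : Continuous fun x => ‖gradient u x‖ ^ 2 := by
    simp only [norm_gradient_sq]
    exact continuous_finsetSum _ fun j _ => (hu.pderiv j).continuous.pow 2
  have hFc : Continuous fun x => ∑ i, hessGrad u i x ^ 2 :=
    continuous_finsetSum _ fun j _ => (hu.hessGrad j).continuous.pow 2
  have hHc : Continuous fun x => ∑ i, ∑ j, hess u x i j ^ 2 :=
    continuous_finsetSum _ fun i _ => continuous_finsetSum _ fun j _ =>
      ((hu.pderiv j).pderiv i).continuous.pow 2
  have hfc : Continuous fun x => deriv f (u x) :=
    (hf.continuous_deriv (by simp)).comp hu.continuous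
  have hDc : Continuous fun x => (∑ i, hessGrad u i x ^ 2) / (‖gradient u x‖ ^ 2 + ε) :=
    hFc.div (hgc.add continuous_const) fun x =>
      (by positivity : 0 < ‖gradient u x‖ ^ 2 + ε).ne'
  have hA := integrableOn_mul_norm_gradient_sq hΩb hgc hη
  have hB : IntegrableOn (fun x => ‖gradient η x‖ ^ 2) Ω := by
    simpa using integrableOn_mul_norm_gradient_sq hΩb (continuous_const (y := (1 : ℝ))) hη
  have hR : IntegrableOn (fun x => (∑ i, ∑ j, hess u x i j ^ 2 -
      deriv f (u x) * ‖gradient u x‖ ^ 2) * η x ^ 2) Ω :=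
    hint ((hHc.sub (hfc.mul hgc)).mul (hηcont.pow 2))
  have hS : IntegrableOn (fun x => deriv f (u x) * η x ^ 2) Ω := hint (hfc.mul (hηcont.pow 2))
  have hG : IntegrableOn (fun x => (∑ i, ∑ j, hess u x i j ^ 2 -
      (∑ i, hessGrad u i x ^ 2) / (‖gradient u x‖ ^ 2 + ε)) * η x ^ 2) Ω :=
    hint ((hHc.sub hDc).mul (hηcont.pow 2))
  have hQ : IntegrableOn (fun x => ∑ i, pderiv i (fun y => η y ^ 2) x * hessGrad u i x) Ω := by
    have hψ : ∃ K, LipschitzWith K fun y => η y ^ 2 := by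
      simpa only [pow_two] using LipschitzWith.exists_mul_of_bounded hη hη hηb hηb
    obtain ⟨K, hψ⟩ := hψ
    exact integrable_finsetSum _ fun i _ => (hint (hu.hessGrad i).continuous).bdd_mul
      (measurable_pderiv _ i).aestronglyMeasurable (.of_forall fun x => hψ.abs_pderiv_le i x)
  have hparts := setIntegral_sum_pderiv_sq_mul_hessGrad (Ω := Ω) hu huc hη hηc hη0
  rw [setIntegral_congr_fun (f := fun x => (∑ i, pderiv i (hessGrad u i) x) * η x ^ 2)
    (g := fun x => (∑ i, ∑ j, hess u x i j ^ 2 -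
    deriv f (u x) * ‖gradient u x‖ ^ 2) * η x ^ 2) hΩ.measurableSet fun x hx => by
      simp only [sum_pderiv_hessGrad_of_semilinear hΩ (hf.differentiable (by simp)) hu hsol hx]]
    at hparts
  have hst := hstab _ hξ fun x hx => by
    have : x ∉ Ω := fun h => hx.2 (hΩ.interior_eq.symm ▸ h)
    simp [hη0 x this]
  obtain ⟨K, hK⟩ := hη
  have hae : ∀ᵐ x ∂(volume.restrict Ω),
      ‖gradient (fun y => √(∑ j, pderiv j u y ^ 2 + ε) * η y) x‖ ^ 2 -
          deriv f (u x) * (√(∑ j, pderiv j u x ^ 2 + ε) * η x) ^ 2 =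
        (((‖gradient u x‖ ^ 2 * ‖gradient η x‖ ^ 2 +
            ε * (‖gradient η x‖ ^ 2 - deriv f (u x) * η x ^ 2)) +
          ∑ i, pderiv i (fun y => η y ^ 2) x * hessGrad u i x) +
          (∑ i, ∑ j, hess u x i j ^ 2 - deriv f (u x) * ‖gradient u x‖ ^ 2) * η x ^ 2) -
          (∑ i, ∑ j, hess u x i j ^ 2 -
            (∑ i, hessGrad u i x ^ 2) / (‖gradient u x‖ ^ 2 + ε)) * η x ^ 2 := by
    filter_upwards [ae_restrict_of_ae hK.ae_differentiableAt] with x hx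
    rw [norm_gradient_sq_sqrt_mul hu hε hx, mul_pow, ← norm_gradient_sq,
      Real.sq_sqrt (by positivity)]
    ring
  have hBS := (hB.fun_sub hS).const_mul ε
  have hABS := hA.fun_add hBS
  have hABSQ := hABS.fun_add hQ
  rw [integral_congr_ae hae, integral_sub (hABSQ.fun_add hR) hG, integral_add hABSQ hR,
    integral_add hABS hQ, integral_add hA hBS,
    hparts, integral_const_mul] at hst
  linarith

end StabilityTest

section SternbergZumbrun

variable {n : ℕ} {Ω : Set (EuclideanSpace ℝ (Fin n))} {u η : EuclideanSpace ℝ (Fin n) → ℝ}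

theorem setIntegral_hess_sub_le_regularized (hΩ : IsOpen Ω) (hΩb : Bornology.IsBounded Ω)
    (hu : ContDiff ℝ ∞ u) (hη : Continuous η) {ε : ℝ} (hε : 0 < ε) :
    ∫ x in Ω ∩ {x | gradient u x ≠ 0},
        ((∑ i, ∑ j, hess u x i j ^ 2) -
          ∑ i, (∑ j, hess u x i j * (gradient u x j / ‖gradient u x‖)) ^ 2) * η x ^ 2 ≤
      ∫ x in Ω, (∑ i, ∑ j, hess u x i j ^ 2 -
        (∑ i, hessGrad u i x ^ 2) / (‖gradient u x‖ ^ 2 + ε)) * η x ^ 2 := by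
  have hgc : Continuous fun x => ‖gradient u x‖ ^ 2 := by
    simp only [norm_gradient_sq]
    exact continuous_finsetSum _ fun j _ => (hu.pderiv j).continuous.pow 2
  have hGc : Continuous fun x => (∑ i, ∑ j, hess u x i j ^ 2 -
      (∑ i, hessGrad u i x ^ 2) / (‖gradient u x‖ ^ 2 + ε)) * η x ^ 2 := by
    refine Continuous.mul (.sub ?_ (.div ?_ (hgc.add continuous_const) fun x =>
      (by positivity : 0 < ‖gradient u x‖ ^ 2 + ε).ne')) (hη.pow 2)
    · exact continuous_finsetSum _ fun i _ => continuous_finsetSum _ fun j _ =>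
        ((hu.pderiv j).pderiv i).continuous.pow 2
    · exact continuous_finsetSum _ fun j _ => (hu.hessGrad j).continuous.pow 2
  have hG : IntegrableOn (fun x => (∑ i, ∑ j, hess u x i j ^ 2 -
      (∑ i, hessGrad u i x ^ 2) / (‖gradient u x‖ ^ 2 + ε)) * η x ^ 2) Ω :=
    (hGc.continuousOn.integrableOn_compact hΩb.isCompact_closure).mono_set subset_closure
  have hmeas : MeasurableSet (Ω ∩ {x | gradient u x ≠ 0}) := by
    have : {x | gradient u x ≠ 0} = {x | ‖gradient u x‖ ^ 2 ≠ 0} := by ext; simp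
    rw [this]
    exact (hΩ.inter (isOpen_ne_fun hgc continuous_const)).measurableSet
  have hle : ∀ x, (∑ i, hessGrad u i x ^ 2) / (‖gradient u x‖ ^ 2 + ε) ≤
      ∑ i, ∑ j, hess u x i j ^ 2 := fun x => by
    rw [div_le_iff₀ (by positivity)]
    have h1 : 0 ≤ (∑ i, ∑ j, hess u x i j ^ 2) * ε := by positivity
    linarith [sum_sq_hessGrad_le u x]
  refine le_trans (integral_mono_of_nonneg ?_ (hG.mono_set Set.inter_subset_left) ?_)
    (setIntegral_mono_set hG (.of_forall fun x =>
      mul_nonneg (sub_nonneg.2 (hle x)) (sq_nonneg _)) Set.inter_subset_left.eventuallyLE)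
  · filter_upwards [ae_restrict_mem hmeas] with x hx
    have hpos : 0 < ‖gradient u x‖ ^ 2 := by
      have := norm_pos_iff.2 hx.2
      positivity
    refine mul_nonneg (sub_nonneg.2 ?_) (sq_nonneg _)
    rw [sum_sq_hess_mul_normalized_gradient, div_le_iff₀ hpos, mul_comm]
    exact sum_sq_hessGrad_le u x
  · filter_upwards [ae_restrict_mem hmeas] with x hx
    have hpos : 0 < ‖gradient u x‖ ^ 2 := by
      have := norm_pos_iff.2 hx.2
      positivity
    rw [sum_sq_hess_mul_normalized_gradient]
    gcongr
    linarith

/-- The Sternberg–Zumbrun inequality for `u` smooth and compactly supported on the whole space and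
`η` vanishing outside `Ω`. -/
theorem IsSemiStable.setIntegral_hess_sub_le (hΩ : IsOpen Ω) (hΩb : Bornology.IsBounded Ω)
    {f : ℝ → ℝ} (hf : ContDiff ℝ ∞ f) (hu : ContDiff ℝ ∞ u) (huc : HasCompactSupport u)
    (hsol : ∀ x ∈ Ω, lapl u x + f (u x) = 0) (hstab : IsSemiStable Ω f u)
    (hη : ∃ K, LipschitzWith K η) (hη0 : ∀ x ∉ Ω, η x = 0) :
    ∫ x in Ω ∩ {x | gradient u x ≠ 0},
        ((∑ i, ∑ j, hess u x i j ^ 2) -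
          ∑ i, (∑ j, hess u x i j * (gradient u x j / ‖gradient u x‖)) ^ 2) * η x ^ 2 ≤
      ∫ x in Ω, ‖gradient u x‖ ^ 2 * ‖gradient η x‖ ^ 2 := by
  set M := ∫ x in Ω, (‖gradient η x‖ ^ 2 - deriv f (u x) * η x ^ 2)
  refine le_of_forall_pos_le_add fun δ hδ => ?_
  have hε : 0 < δ / (|M| + 1) := by positivity
  refine ((setIntegral_hess_sub_le_regularized hΩ hΩb hu hη.choose_spec.continuous hε).trans
    (hstab.setIntegral_regularized_le hΩ hΩb hf hu huc hsol hη hη0 hε)).trans ?_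
  gcongr
  rw [div_mul_eq_mul_div, div_le_iff₀ (by positivity)]
  gcongr
  linarith [le_abs_self M]

theorem exists_contDiff_hasCompactSupport_eqOn {U K : Set (EuclideanSpace ℝ (Fin n))}
    (hU : IsOpen U) (hK : IsCompact K) (hKU : K ⊆ U) (hu : ContDiffOn ℝ ∞ u U) :
    ∃ v, ContDiff ℝ ∞ v ∧ HasCompactSupport v ∧ Set.EqOn v u K := by
  obtain ⟨L, hL, hKL, hLU⟩ := exists_compact_between hK hU hKU
  obtain ⟨χ, hχ1, hχ0, -⟩ := exists_contMDiffMap_one_nhds_of_subset_interior (n := ⊤)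
    (𝓘(ℝ, EuclideanSpace ℝ (Fin n))) hK.isClosed hKL
  have hχ : ContDiff ℝ ∞ χ := χ.contMDiff.contDiff
  refine ⟨fun x => χ x * u x, contDiff_iff_contDiffAt.2 fun x => ?_,
    HasCompactSupport.intro hL fun x hx => by simp [hχ0 x hx], fun x hx => ?_⟩
  · by_cases hx : x ∈ L
    · exact hχ.contDiffAt.mul (hu.contDiffAt (hU.mem_nhds (hLU hx)))
    · have h : (fun y => χ y * u y) =ᶠ[𝓝 x] fun _ => 0 := by
        filter_upwards [hL.isClosed.isOpen_compl.mem_nhds hx] with y hy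
        simp [hχ0 y hy]
      exact contDiffAt_const.congr_of_eventuallyEq h
  · simp [hχ1.self_of_nhdsSet x hx]

theorem IsSemiStable.congr (hΩ : IsOpen Ω) {f : ℝ → ℝ} {v : EuclideanSpace ℝ (Fin n) → ℝ}
    (h : Set.EqOn u v Ω) (hu : IsSemiStable Ω f u) : IsSemiStable Ω f v := by
  intro ξ hξ hξ0
  refine (hu ξ hξ hξ0).trans_eq (setIntegral_congr_fun hΩ.measurableSet fun x hx => ?_)
  simp only [h hx]

end SternbergZumbrun

/-- (Sternberg–Zumbrun inequality.) -/
theorem sternberg_zumbrun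
    (n : ℕ) (hn : 2 ≤ n)
    (Ω : Set (EuclideanSpace ℝ (Fin n))) (hΩ : IsSmoothBoundedDomain Ω)
    (f : ℝ → ℝ) (hf : ContDiff ℝ (⊤ : ℕ∞) f)
    (u : EuclideanSpace ℝ (Fin n) → ℝ)
    (husmooth : ∃ U, IsOpen U ∧ closure Ω ⊆ U ∧ ContDiffOn ℝ (⊤ : ℕ∞) u U)
    (hsol : IsClassicalSol Ω f u) (hstab : IsSemiStable Ω f u)
    (hpos : ∀ x ∈ Ω, 0 < u x)
    (η : EuclideanSpace ℝ (Fin n) → ℝ)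
    (hη : ∃ K : NNReal, LipschitzWith K η)
    (hη0 : ∀ x ∈ frontier Ω, η x = 0) :
    (∫ x in Ω ∩ {x | gradient u x ≠ 0},
        ((∑ i, ∑ j, hess u x i j ^ 2) -
          ∑ i, (∑ j, hess u x i j * (gradient u x j / ‖gradient u x‖)) ^ 2) * η x ^ 2)
      ≤ ∫ x in Ω, ‖gradient u x‖ ^ 2 * ‖gradient η x‖ ^ 2 := by
  obtain ⟨hΩo, hΩb, -, -⟩ := hΩ
  obtain ⟨U, hU, hΩU, huU⟩ := husmooth
  obtain ⟨v, hv, hvc, hvu⟩ := exists_contDiff_hasCompactSupport_eqOn hU hΩb.isCompact_closure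
    hΩU huU
  have hvΩ : Set.EqOn v u Ω := hvu.mono subset_closure
  have hnear : ∀ x ∈ Ω, v =ᶠ[𝓝 x] u := fun x hx => hvΩ.eventuallyEq_of_mem (hΩo.mem_nhds hx)
  obtain ⟨K, hK⟩ := hη
  have hηΩ : ∀ x ∈ Ω, Ω.indicator η =ᶠ[𝓝 x] η := fun x hx =>
    (Set.eqOn_indicator (f := η)).eventuallyEq_of_mem (hΩo.mem_nhds hx)
  have hgrad : ∀ x ∈ Ω, gradient v x = gradient u x := fun x hx => (hnear x hx).gradient_eq
  have key := (hstab.congr hΩo hvΩ.symm).setIntegral_hess_sub_le hΩo hΩb hf hv hvc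
    (fun x hx => by rw [(hnear x hx).lapl_eq, hvΩ hx, hsol.2.1 x hx])
    ⟨K, hK.indicator_of_eq_zero_frontier hη0⟩
    fun x hx => Set.indicator_of_notMem hx η
  have hset : Ω ∩ {x | gradient v x ≠ 0} = Ω ∩ {x | gradient u x ≠ 0} := by
    ext x
    refine and_congr_right fun hx => ?_
    simp only [Set.mem_ofPred_eq, hgrad x hx]
  have hmeas : MeasurableSet (Ω ∩ {x | gradient v x ≠ 0}) := by
    refine hΩo.measurableSet.inter ?_
    have : {x | gradient v x ≠ 0} = {x | ∑ i, pderiv i v x ^ 2 ≠ 0} := by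
      ext x
      simp [← norm_gradient_sq]
    rw [this]
    exact (isOpen_ne_fun (continuous_finsetSum _ fun j _ => (hv.pderiv j).continuous.pow 2)
      continuous_const).measurableSet
  rw [setIntegral_congr_fun hmeas fun x hx => by
      simp only [(hnear x hx.1).hess_eq, hgrad x hx.1, (hηΩ x hx.1).eq_of_nhds]; rfl,
    setIntegral_congr_fun hΩo.measurableSet fun x hx => by
      simp only [hgrad x hx, (hηΩ x hx).gradient_eq]; rfl, hset] at key
  exact key
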